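/- arXiv:math/0505606 — 5 statements merged into one kernel-verified Lean document; each statement's English description precedes it below -/
import Mathlib

section
/- Let q > 0 and 0 < α < q, and let ν be a probability measure on [0, ∞). Suppose that the pushforward of the product measure (Gamma distribution with shape q and scale 1) ⊗ ν under the map (t, x) ↦ t·x equals the Gamma distribution with shape α and scale 1. Then ν equals the Beta distribution with parameters (α, q − α). -/
open MeasureTheory Set

/-- The Gamma distribution with shape `a` and scale 1: density
`t ^ (a-1) * exp (-t) / Γ(a)` on `(0, ∞)`. -/
noncomputable def gammaM (a : ℝ) : Measure ℝ :=
  (volume.restrict (Ioi (0:ℝ))).withDensity fun t =>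
    ENNReal.ofReal (t ^ (a - 1) * Real.exp (-t) / Real.Gamma a)

/-- The Beta distribution with parameters `a, b`: density
`u ^ (a-1) * (1-u) ^ (b-1) / B(a,b)` on `(0,1)`, where `B(a,b) = Γ(a)Γ(b)/Γ(a+b)`. -/
noncomputable def betaM (a b : ℝ) : Measure ℝ :=
  (volume.restrict (Ioo (0:ℝ) 1)).withDensity fun u =>
    ENNReal.ofReal (u ^ (a - 1) * (1 - u) ^ (b - 1) /
      (Real.Gamma a * Real.Gamma b / Real.Gamma (a + b)))

/-- The moments of the Gamma distribution. -/
lemma lintegral_pow_gammaM {a : ℝ} (ha : 0 < a) (n : ℕ) :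
    ∫⁻ t, ENNReal.ofReal t ^ n ∂gammaM a
      = ENNReal.ofReal (Real.Gamma (a + n) / Real.Gamma a) := by
  have han : 0 < a + n := by positivity
  have hΓ : 0 < Real.Gamma a := Real.Gamma_pos_of_pos ha
  rw [gammaM, lintegral_withDensity_eq_lintegral_mul _ (by fun_prop) (by fun_prop),
    setLIntegral_congr_fun (g := fun t => ENNReal.ofReal
      (Real.exp (-t) * t ^ (a + n - 1) / Real.Gamma a)) measurableSet_Ioi,
    ← ofReal_integral_eq_lintegral_ofReal, integral_div, ← Real.Gamma_eq_integral han]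
  · exact (Real.GammaIntegral_convergent han).div_const _
  · refine ae_restrict_of_forall_mem measurableSet_Ioi fun t (ht : 0 < t) => ?_
    change 0 ≤ Real.exp (-t) * t ^ (a + n - 1) / Real.Gamma a
    positivity
  · intro t (ht : 0 < t)
    simp only [Pi.mul_apply]
    rw [← ENNReal.ofReal_pow ht.le, ← ENNReal.ofReal_mul (by positivity),
      add_sub_right_comm, Real.rpow_add ht, Real.rpow_natCast]
    congr 1
    ring

open ProbabilityTheory in
/-- The moments of the Beta distribution. -/
lemma lintegral_pow_betaM {a b : ℝ} (ha : 0 < a) (hb : 0 < b) (n : ℕ) :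
    ∫⁻ u, ENNReal.ofReal u ^ n ∂betaM a b
      = ENNReal.ofReal (beta (a + n) b / beta a b) := by
  have han : 0 < a + n := by positivity
  have h₁ := beta_pos ha hb
  have h₂ := beta_pos han hb
  have h₃ := lintegral_betaPDF_eq_one han hb
  rw [lintegral_betaPDF] at h₃
  rw [betaM, lintegral_withDensity_eq_lintegral_mul _ (by fun_prop) (by fun_prop),
    setLIntegral_congr_fun (g := fun u => ENNReal.ofReal (beta (a + n) b / beta a b) *
      ENNReal.ofReal (1 / beta (a + n) b * u ^ (a + n - 1) * (1 - u) ^ (b - 1)))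
      measurableSet_Ioo,
    lintegral_const_mul _ (by fun_prop), h₃, mul_one]
  intro u ⟨hu, _⟩
  simp only [Pi.mul_apply]
  rw [← ENNReal.ofReal_pow hu.le, ← ENNReal.ofReal_mul' (by positivity),
    ← ENNReal.ofReal_mul (by positivity),
    add_sub_right_comm, Real.rpow_add hu, Real.rpow_natCast]
  congr 1
  change _ / beta a b * _ = _
  field_simp

lemma gammaM_Iio (a : ℝ) : gammaM a (Iio 0) = 0 :=
  withDensity_absolutelyContinuous _ _ <| by
    rw [Measure.restrict_apply measurableSet_Iio, Iio_inter_Ioi, Ioo_self, measure_empty]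

lemma betaM_compl_Icc (a b : ℝ) : betaM a b (Icc 0 1)ᶜ = 0 :=
  withDensity_absolutelyContinuous _ _ <| by
    rw [Measure.restrict_apply measurableSet_Icc.compl]
    convert measure_empty (μ := volume)
    ext x
    simp only [mem_inter_iff, mem_compl_iff, mem_Icc, mem_Ioo, mem_empty_iff_false]
    grind

lemma isProbabilityMeasure_betaM {a b : ℝ} (ha : 0 < a) (hb : 0 < b) :
    IsProbabilityMeasure (betaM a b) where
  measure_univ := by
    simpa [div_self (ProbabilityTheory.beta_pos ha hb).ne'] using lintegral_pow_betaM ha hb 0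

/-- A finite measure whose moments are bounded gives no mass to `(1, ∞)`. -/
lemma measure_Ioi_one_eq_zero {ν : Measure ℝ} [IsFiniteMeasure ν]
    (h : ∀ n : ℕ, ∫⁻ x, ENNReal.ofReal x ^ n ∂ν ≤ 1) : ν (Ioi 1) = 0 := by
  have key : ∀ c : ℝ, 1 < c → ν (Ici c) = 0 := by
    intro c hc
    by_contra hne
    have hc' : 1 < ENNReal.ofReal c := by simpa using hc
    have hbound (n : ℕ) : ENNReal.ofReal c ^ n ≤ (ν (Ici c))⁻¹ := by
      rw [ENNReal.le_inv_iff_mul_le]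
      calc ENNReal.ofReal c ^ n * ν (Ici c)
          ≤ ENNReal.ofReal c ^ n * ν {x | ENNReal.ofReal c ^ n ≤ ENNReal.ofReal x ^ n} := by
            gcongr
            intro x (hx : c ≤ x)
            change ENNReal.ofReal c ^ n ≤ ENNReal.ofReal x ^ n
            gcongr
        _ ≤ ∫⁻ x, ENNReal.ofReal x ^ n ∂ν := mul_meas_ge_le_lintegral (by fun_prop) _
        _ ≤ 1 := h n
    have := le_of_tendsto' (ENNReal.tendsto_pow_atTop_nhds_top_iff.2 hc') hbound
    exact hne (by simpa using this)
  have hU : Ioi (1 : ℝ) = ⋃ n : ℕ, Ici (1 + 1 / ((n : ℝ) + 1)) := by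
    ext x
    simp only [mem_Ioi, mem_iUnion, mem_Ici]
    refine ⟨fun hx => ?_, fun ⟨n, hn⟩ => lt_of_lt_of_le (by simp; positivity) hn⟩
    obtain ⟨n, hn⟩ := exists_nat_one_div_lt (sub_pos.2 hx)
    exact ⟨n, by linarith⟩
  rw [hU, measure_iUnion_null_iff]
  exact fun n => key _ (by simp; positivity)

/-- Probability measures on `[0, 1]` are determined by their moments. -/
lemma ext_of_moments_of_Icc {μ ν : Measure ℝ} [IsProbabilityMeasure μ] [IsProbabilityMeasure ν]
    (hμ : ∀ᵐ x ∂μ, x ∈ Icc (0 : ℝ) 1) (hν : ∀ᵐ x ∂ν, x ∈ Icc (0 : ℝ) 1)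
    (h : ∀ n : ℕ, ∫⁻ x, ENNReal.ofReal x ^ n ∂μ = ∫⁻ x, ENNReal.ofReal x ^ n ∂ν) : μ = ν := by
  have hint (ρ : Measure ℝ) [IsProbabilityMeasure ρ] (hρ : ∀ᵐ x ∂ρ, x ∈ Icc (0 : ℝ) 1)
      (f : ℝ → ℝ) (hf : Continuous f) : Integrable f ρ := by
    obtain ⟨C, hC⟩ := (isCompact_Icc (a := (0 : ℝ)) (b := 1)).exists_bound_of_continuousOn
      hf.continuousOn
    exact Integrable.of_bound hf.aestronglyMeasurable C (hρ.mono hC)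
  have hmom (ρ : Measure ℝ) (hρ : ∀ᵐ x ∂ρ, x ∈ Icc (0 : ℝ) 1)
      (n : ℕ) : ∫ x, x ^ n ∂ρ = (∫⁻ x, ENNReal.ofReal x ^ n ∂ρ).toReal := by
    rw [integral_eq_lintegral_of_nonneg_ae (hρ.mono fun x hx => pow_nonneg hx.1 n)
      (by fun_prop)]
    congr 1
    exact lintegral_congr_ae (hρ.mono fun x hx => ENNReal.ofReal_pow hx.1 n)
  have hpoly (p : Polynomial ℝ) : ∫ x, p.eval x ∂μ = ∫ x, p.eval x ∂ν := by
    simp_rw [Polynomial.eval_eq_sum_range]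
    rw [integral_finsetSum _ fun i _ => hint μ hμ _ (by fun_prop),
      integral_finsetSum _ fun i _ => hint ν hν _ (by fun_prop)]
    simp_rw [integral_const_mul, hmom μ hμ, hmom ν hν, h]
  have happrox (ρ : Measure ℝ) [IsProbabilityMeasure ρ] (hρ : ∀ᵐ x ∂ρ, x ∈ Icc (0 : ℝ) 1)
      (f : ℝ → ℝ) (hf : Continuous f) (p : Polynomial ℝ) (ε : ℝ)
      (hp : ∀ x ∈ Icc (0 : ℝ) 1, |p.eval x - f x| < ε) :
      |∫ x, p.eval x ∂ρ - ∫ x, f x ∂ρ| ≤ ε := by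
    rw [← integral_sub (hint ρ hρ _ p.continuous) (hint ρ hρ _ hf)]
    simpa using norm_integral_le_of_norm_le_const (f := fun x => p.eval x - f x) (C := ε)
      (hρ.mono fun x hx => (hp x hx).le)
  refine ext_of_forall_integral_eq_of_IsFiniteMeasure fun f => ?_
  refine eq_of_abs_sub_le_all fun ε hε => ?_
  obtain ⟨p, hp⟩ := exists_polynomial_near_of_continuousOn 0 1 f f.continuous.continuousOn
    (ε / 2) (by positivity)
  have h₁ := happrox μ hμ f f.continuous p _ hp
  have h₂ := happrox ν hν f f.continuous p _ hp
  rw [hpoly p] at h₁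
  rw [abs_le] at *
  constructor <;> linarith

theorem stmt4 (q α : ℝ) (hq : 0 < q) (hα : 0 < α) (hαq : α < q)
    (ν : Measure ℝ) [IsProbabilityMeasure ν] (hν : ν (Iio 0) = 0)
    (h : ((gammaM q).prod ν).map (fun p => p.1 * p.2) = gammaM α) :
    ν = betaM α (q - α) := by
  have hβ : 0 < q - α := sub_pos.2 hαq
  have := isProbabilityMeasure_betaM hα hβ
  have hsfin : SFinite (gammaM q) := by unfold gammaM; infer_instance
  have hγ : ∀ᵐ p ∂(gammaM q).prod ν, 0 ≤ p.1 := by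
    refine Measure.quasiMeasurePreserving_fst.ae (p := fun t => 0 ≤ t) ?_
    rw [ae_iff]
    simp only [not_le]
    exact gammaM_Iio q
  have hprod (n : ℕ) : ENNReal.ofReal (Real.Gamma (q + n) / Real.Gamma q) *
      ∫⁻ x, ENNReal.ofReal x ^ n ∂ν = ENNReal.ofReal (Real.Gamma (α + n) / Real.Gamma α) := by
    rw [← lintegral_pow_gammaM hα, ← lintegral_pow_gammaM hq, ← h,
      lintegral_map (by fun_prop) (by fun_prop),
      ← lintegral_prod_mul (by fun_prop) (by fun_prop)]
    refine lintegral_congr_ae (hγ.mono fun p hp => ?_)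
    simp only [ENNReal.ofReal_mul hp, mul_pow]
  have hmom (n : ℕ) :
      ∫⁻ x, ENNReal.ofReal x ^ n ∂ν = ∫⁻ x, ENNReal.ofReal x ^ n ∂betaM α (q - α) := by
    have g₁ := Real.Gamma_pos_of_pos hq
    have g₂ : 0 < Real.Gamma (q + n) := Real.Gamma_pos_of_pos (by positivity)
    have g₃ := Real.Gamma_pos_of_pos hα
    have g₄ := Real.Gamma_pos_of_pos hβ
    have g₅ : 0 < Real.Gamma (q + n) / Real.Gamma q := by positivity
    rw [← ENNReal.mul_right_inj (ENNReal.ofReal_pos.2 g₅).ne' ENNReal.ofReal_ne_top, hprod n,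
      lintegral_pow_betaM hα hβ, ← ENNReal.ofReal_mul g₅.le]
    congr 1
    simp only [ProbabilityTheory.beta]
    rw [show α + n + (q - α) = q + n by ring, show α + (q - α) = q by ring]
    field_simp
  have hbeta : ∀ᵐ x ∂betaM α (q - α), x ∈ Icc (0 : ℝ) 1 := betaM_compl_Icc _ _
  have hle (n : ℕ) : ∫⁻ x, ENNReal.ofReal x ^ n ∂ν ≤ 1 := by
    rw [hmom n]
    calc _ ≤ ∫⁻ _, 1 ∂betaM α (q - α) :=
          lintegral_mono_ae (hbeta.mono fun x hx => pow_le_one₀ zero_le (by simpa using hx.2))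
      _ = 1 := by simp
  refine ext_of_moments_of_Icc ?_ hbeta hmom
  refine measure_mono_null (t := Iio 0 ∪ Ioi 1) (fun x hx => ?_)
    (measure_union_null hν (measure_Ioi_one_eq_zero hle))
  by_contra hx'
  simp only [mem_union, mem_Iio, mem_Ioi, not_or, not_lt] at hx'
  exact hx hx'
end

section
/- Let θ > 0 and let n ≥ 1 be an integer; set a = θ + n/2. Then the pushforward of the product measure (Gamma distribution with shape θ and scale 1) ⊗ (Beta distribution with parameters (a, a)) ⊗ (Gamma distribution with shape n/2 and scale 1) under the map (t, u, s) ↦ t·u + s equals the pushforward of the product measure (Gamma distribution with shape θ+n and scale 1) ⊗ (Beta distribution with parameters (a, a)) under the map (t, u) ↦ t·u. That is, with all variables independent, T_θ·U_{θ+n/2,θ+n/2} + T_{n/2} is equal in distribution to T_{θ+n}·U_{θ+n/2,θ+n/2}. -/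
open MeasureTheory Set

open ProbabilityTheory in
/-- Finite measures on `ℝ` are equal if their moment-generating functions are finite and agree
near `0`. -/
theorem ext_of_lintegral_exp {μ ν : Measure ℝ} [IsFiniteMeasure μ] [IsFiniteMeasure ν]
    {r : ℝ} (hr : 0 < r)
    (hfin : ∀ t ∈ Ioo (-r) r, ∫⁻ x, ENNReal.ofReal (Real.exp (t * x)) ∂μ ≠ ⊤)
    (heq : ∀ t ∈ Ioo (-r) r, ∫⁻ x, ENNReal.ofReal (Real.exp (t * x)) ∂μ =
      ∫⁻ x, ENNReal.ofReal (Real.exp (t * x)) ∂ν) : μ = ν := by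
  have integrable_of_fin {ρ : Measure ℝ} {t : ℝ}
      (h : ∫⁻ x, ENNReal.ofReal (Real.exp (t * x)) ∂ρ ≠ ⊤) :
      Integrable (fun x => Real.exp (t * x)) ρ :=
    (lintegral_ofReal_ne_top_iff_integrable (by fun_prop)
      (ae_of_all _ fun x => (Real.exp_pos _).le)).mp h
  have interior_of_subset {ρ : Measure ℝ} (h : Ioo (-r) r ⊆ integrableExpSet id ρ) :
      Ioo (-r) r ⊆ interior (integrableExpSet id ρ) :=
    interior_maximal h isOpen_Ioo
  have hμ := interior_of_subset (ρ := μ) fun t ht => integrable_of_fin (hfin t ht)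
  have hν := interior_of_subset (ρ := ν) fun t ht => integrable_of_fin (heq t ht ▸ hfin t ht)
  have hmgf : ∀ t ∈ Ioo (-r) r, mgf id μ t = mgf id ν t := by
    intro t ht
    simp only [mgf, id]
    rw [integral_eq_lintegral_of_nonneg_ae (ae_of_all _ fun x => (Real.exp_pos _).le)
        (by fun_prop),
      integral_eq_lintegral_of_nonneg_ae (ae_of_all _ fun x => (Real.exp_pos _).le)
        (by fun_prop), heq t ht]
  have key : EqOn (complexMGF id μ) (complexMGF id ν) {z | z.re ∈ Ioo (-r) r} := by
    refine AnalyticOnNhd.eqOn_of_preconnected_of_frequently_eq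
      (analyticOnNhd_complexMGF.mono fun z hz => hμ hz)
      (analyticOnNhd_complexMGF.mono fun z hz => hν hz)
      ((convex_Ioo (-r) r).linear_preimage Complex.reLm).isPreconnected
      (z₀ := 0) (by simp [hr]) ?_
    have h0 : Filter.Tendsto (fun x : ℝ => (x : ℂ)) (nhdsWithin 0 {0}ᶜ) (nhdsWithin 0 {0}ᶜ) := by
      refine tendsto_nhdsWithin_iff.mpr ⟨?_, ?_⟩
      · exact (Complex.continuous_ofReal.tendsto' 0 0 (by simp)).mono_left nhdsWithin_le_nhds
      · filter_upwards [self_mem_nhdsWithin] with x hx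
        simpa using hx
    refine h0.frequently (Filter.Eventually.frequently ?_)
    filter_upwards [nhdsWithin_le_nhds (Ioo_mem_nhds (neg_lt_zero.mpr hr) hr)] with x hx
    rw [complexMGF_ofReal, complexMGF_ofReal, hmgf x hx]
  refine Measure.ext_of_charFun ?_
  ext t
  rw [← complexMGF_id_mul_I, ← complexMGF_id_mul_I]
  exact key (by simp [hr])

theorem lintegral_gammaM (a : ℝ) (f : ℝ → ENNReal) (hf : Measurable f) :
    ∫⁻ t, f t ∂gammaM a = ∫⁻ t in Ioi (0 : ℝ),
      ENNReal.ofReal (t ^ (a - 1) * Real.exp (-t) / Real.Gamma a) * f t := by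
  rw [gammaM, lintegral_withDensity_eq_lintegral_mul _ (by fun_prop) hf]
  rfl

theorem lintegral_betaM (a b : ℝ) (f : ℝ → ENNReal) (hf : Measurable f) :
    ∫⁻ u, f u ∂betaM a b = ∫⁻ u in Ioo (0 : ℝ) 1,
      ENNReal.ofReal (u ^ (a - 1) * (1 - u) ^ (b - 1) /
        (Real.Gamma a * Real.Gamma b / Real.Gamma (a + b))) * f u := by
  rw [betaM, lintegral_withDensity_eq_lintegral_mul _ (by fun_prop) hf]
  rfl

instance (a : ℝ) : SFinite (gammaM a) := by unfold gammaM; infer_instance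

instance (a b : ℝ) : SFinite (betaM a b) := by unfold betaM; infer_instance

theorem lintegral_exp_gammaM {a l : ℝ} (ha : 0 < a) (hl : 0 < 1 + l) :
    ∫⁻ s, ENNReal.ofReal (Real.exp (-(l * s))) ∂gammaM a =
      ENNReal.ofReal ((1 + l) ^ (-a)) := by
  have hG := Real.Gamma_pos_of_pos ha
  have hval := Real.integral_rpow_mul_exp_neg_mul_Ioi ha hl
  have hI : IntegrableOn (fun t : ℝ => t ^ (a - 1) * Real.exp (-((1 + l) * t))) (Ioi 0) := by
    by_contra h
    rw [integral_undef h] at hval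
    have : 0 < (1 / (1 + l)) ^ a * Real.Gamma a := by positivity
    exact this.ne hval
  rw [lintegral_gammaM a _ (by fun_prop)]
  have : ∀ t ∈ Ioi (0 : ℝ), ENNReal.ofReal (t ^ (a - 1) * Real.exp (-t) / Real.Gamma a) *
      ENNReal.ofReal (Real.exp (-(l * t))) =
      ENNReal.ofReal (t ^ (a - 1) * Real.exp (-((1 + l) * t)) / Real.Gamma a) := by
    intro t ht
    have ht : 0 < t := ht
    rw [← ENNReal.ofReal_mul (by positivity),
      show -((1 + l) * t) = -t + -(l * t) by ring, Real.exp_add]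
    congr 1
    ring
  rw [setLIntegral_congr_fun measurableSet_Ioi this, ← ofReal_integral_eq_lintegral_ofReal
    (hI.div_const _), integral_div, hval, mul_div_assoc, div_self hG.ne', mul_one,
    one_div, Real.inv_rpow hl.le, Real.rpow_neg hl.le]
  filter_upwards [ae_restrict_mem measurableSet_Ioi] with t ht
  have ht : 0 < t := ht
  positivity

theorem isFiniteMeasure_gammaM {a : ℝ} (ha : 0 < a) : IsFiniteMeasure (gammaM a) := by
  have h := lintegral_exp_gammaM (l := 0) ha (by simp)
  exact ⟨by simp_all⟩

theorem betaM_eq_betaMeasure (a b : ℝ) : betaM a b = ProbabilityTheory.betaMeasure a b := by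
  rw [betaM, ← withDensity_indicator measurableSet_Ioo, ProbabilityTheory.betaMeasure]
  congr 1
  ext u
  simp only [indicator, mem_Ioo, ProbabilityTheory.betaPDF_eq, ProbabilityTheory.beta]
  split_ifs
  · congr 1
    ring
  · simp

theorem isFiniteMeasure_betaM {a b : ℝ} (ha : 0 < a) (hb : 0 < b) :
    IsFiniteMeasure (betaM a b) := by
  have := ProbabilityTheory.isProbabilityMeasureBeta ha hb
  rw [betaM_eq_betaMeasure]
  infer_instance

theorem ae_betaM_mem_Ioo (a b : ℝ) : ∀ᵐ u ∂betaM a b, u ∈ Ioo (0 : ℝ) 1 :=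
  (withDensity_absolutelyContinuous _ _).ae_le (ae_restrict_mem measurableSet_Ioo)

theorem one_add_mul_pos {l u : ℝ} (hl : 0 < 1 + l) (hu : u ∈ Ioo (0 : ℝ) 1) :
    0 < 1 + l * u := by
  nlinarith [hu.1, hu.2, mul_pos hl hu.1]

theorem lintegral_one_add_mul_rpow_betaM_ne_top {a b c l : ℝ} (ha : 0 < a) (hb : 0 < b)
    (hc : 0 < c) (hl : 0 < 1 + l) :
    ∫⁻ u, ENNReal.ofReal ((1 + l * u) ^ (-c)) ∂betaM a b ≠ ⊤ := by
  have := isFiniteMeasure_betaM ha hb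
  have hm : 0 < min 1 (1 + l) := lt_min one_pos hl
  refine ne_top_of_le_ne_top (b := ∫⁻ _, ENNReal.ofReal (min 1 (1 + l) ^ (-c)) ∂betaM a b) ?_ ?_
  · rw [lintegral_const]
    exact ENNReal.mul_ne_top ENNReal.ofReal_ne_top (measure_ne_top _ _)
  · refine lintegral_mono_ae ?_
    filter_upwards [ae_betaM_mem_Ioo a b] with u hu
    refine ENNReal.ofReal_le_ofReal (Real.rpow_le_rpow_of_nonpos hm ?_ (by linarith))
    rcases le_total 0 l with h | h
    · exact (min_le_left _ _).trans (by nlinarith [hu.1])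
    · exact (min_le_right _ _).trans (by nlinarith [hu.2])

/-- The Euler transformation of a hypergeometric function, in integral form. -/
theorem lintegral_one_add_mul_rpow_betaM {a c l : ℝ} (hl : 0 < 1 + l) :
    ∫⁻ u, ENNReal.ofReal ((1 + l * u) ^ (-c)) ∂betaM a a =
      ENNReal.ofReal ((1 + l) ^ (a - c)) *
        ∫⁻ u, ENNReal.ofReal ((1 + l * u) ^ (-(2 * a - c))) ∂betaM a a := by
  set φ : ℝ → ℝ := fun u => (1 - u) / (1 + l * u) with hφ
  have hpos : ∀ u ∈ Ioo (0 : ℝ) 1, 0 < 1 + l * u := fun u hu => one_add_mul_pos hl hu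
  have hsub : ∀ u ∈ Ioo (0 : ℝ) 1, 1 - φ u = u * (1 + l) / (1 + l * u) := by
    intro u hu
    have := (hpos u hu).ne'
    simp only [hφ]
    rw [eq_div_iff this, sub_mul, div_mul_cancel₀ _ this]
    ring
  have hadd : ∀ u ∈ Ioo (0 : ℝ) 1, 1 + l * φ u = (1 + l) / (1 + l * u) := by
    intro u hu
    have := (hpos u hu).ne'
    simp only [hφ]
    field_simp
    ring
  have hmaps : MapsTo φ (Ioo 0 1) (Ioo 0 1) := by
    intro u hu
    refine ⟨div_pos (sub_pos.mpr hu.2) (hpos u hu), sub_pos.mp ?_⟩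
    rw [hsub u hu]
    exact div_pos (mul_pos hu.1 hl) (hpos u hu)
  have hinv : LeftInvOn φ φ (Ioo 0 1) := by
    intro u hu
    have := (hpos u hu).ne'
    change (1 - φ u) / (1 + l * φ u) = u
    rw [hsub u hu, hadd u hu, div_div_div_cancel_right₀ this, mul_div_cancel_right₀ _ hl.ne']
  have himg : φ '' Ioo 0 1 = Ioo 0 1 :=
    hmaps.image_subset.antisymm fun u hu => ⟨φ u, hmaps hu, hinv hu⟩
  have hderiv : ∀ u ∈ Ioo (0 : ℝ) 1,
      HasDerivWithinAt φ (-(1 + l) / (1 + l * u) ^ 2) (Ioo 0 1) u := by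
    intro u hu
    have h := (((hasDerivAt_id u).const_sub 1).div (((hasDerivAt_id u).const_mul l).const_add 1)
      (hpos u hu).ne').hasDerivWithinAt (s := Ioo 0 1)
    refine h.congr_deriv ?_
    simp only [id]
    congr 1
    ring
  rw [lintegral_betaM _ _ _ (by fun_prop), lintegral_betaM _ _ _ (by fun_prop),
    ← lintegral_const_mul _ (by fun_prop)]
  conv_lhs => rw [← himg]
  rw [lintegral_image_eq_lintegral_abs_deriv_mul measurableSet_Ioo hderiv hinv.injOn]
  refine setLIntegral_congr_fun measurableSet_Ioo fun u hu => ?_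
  have hu' := hpos u hu
  have h0 := hu.1
  have h1 : 0 < 1 - u := sub_pos.mpr hu.2
  rw [hadd u hu, hsub u hu, abs_div, abs_neg, abs_of_pos hl, abs_of_pos (pow_pos hu' 2)]
  simp only [hφ]
  rw [← ENNReal.ofReal_mul' (by positivity), ← ENNReal.ofReal_mul (by positivity),
    ← ENNReal.ofReal_mul' (by positivity), ← ENNReal.ofReal_mul (by positivity)]
  congr 1
  rw [Real.div_rpow h1.le hu'.le, Real.div_rpow (by positivity) hu'.le,
    Real.mul_rpow h0.le hl.le, Real.div_rpow hl.le hu'.le]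
  have e1 : (1 + l) ^ (a - c) = (1 + l) ^ (a - 1) * (1 + l) ^ (-c) * (1 + l) := by
    rw [← Real.rpow_add hl, ← Real.rpow_add_one hl.ne']
    congr 1
    ring
  have e2 : (1 + l * u) ^ (-(2 * a - c)) = ((1 + l * u) ^ (a - 1) * (1 + l * u) ^ (a - 1) *
      (1 + l * u) ^ (-c) * (1 + l * u) ^ 2)⁻¹ := by
    rw [← Real.rpow_natCast, ← Real.rpow_add hu', ← Real.rpow_add hu', ← Real.rpow_add hu',
      ← Real.rpow_neg hu'.le]
    congr 1
    push_cast
    ring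
  rw [e1, e2]
  simp only [div_eq_mul_inv, mul_inv]
  ring

/-- The Laplace transform of `T * U` with `T` Gamma and `U` Beta distributed. -/
theorem lintegral_exp_gammaM_mul_betaM {a b c l : ℝ} (hc : 0 < c) (hl : 0 < 1 + l) :
    ∫⁻ u, ∫⁻ t, ENNReal.ofReal (Real.exp (-(l * (t * u)))) ∂gammaM c ∂betaM a b =
      ∫⁻ u, ENNReal.ofReal ((1 + l * u) ^ (-c)) ∂betaM a b := by
  refine lintegral_congr_ae ?_
  filter_upwards [ae_betaM_mem_Ioo a b] with u hu
  rw [← lintegral_exp_gammaM hc (one_add_mul_pos hl hu)]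
  congr! 5 with t
  ring

theorem lintegral_exp_map_mul {a b c l : ℝ} (hc : 0 < c) (hl : 0 < 1 + l) :
    ∫⁻ x, ENNReal.ofReal (Real.exp (-(l * x)))
        ∂((gammaM c).prod (betaM a b)).map (fun p => p.1 * p.2) =
      ∫⁻ u, ENNReal.ofReal ((1 + l * u) ^ (-c)) ∂betaM a b := by
  rw [lintegral_map (by fun_prop) (by fun_prop), lintegral_prod_symm' _ (by fun_prop),
    lintegral_exp_gammaM_mul_betaM hc hl]

theorem lintegral_exp_map_mul_add {a b c d l : ℝ} (hc : 0 < c) (hd : 0 < d) (hl : 0 < 1 + l) :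
    ∫⁻ x, ENNReal.ofReal (Real.exp (-(l * x)))
        ∂((gammaM c).prod ((betaM a b).prod (gammaM d))).map (fun p => p.1 * p.2.1 + p.2.2) =
      (∫⁻ u, ENNReal.ofReal ((1 + l * u) ^ (-c)) ∂betaM a b) *
        ENNReal.ofReal ((1 + l) ^ (-d)) := by
  rw [lintegral_map (by fun_prop) (by fun_prop), lintegral_prod_symm' _ (by fun_prop),
    ← lintegral_exp_gammaM_mul_betaM hc hl, ← lintegral_exp_gammaM hd hl,
    ← lintegral_prod_mul (Measurable.lintegral_prod_left' (f := fun p : ℝ × ℝ =>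
      ENNReal.ofReal (Real.exp (-(l * (p.1 * p.2))))) (by fun_prop)).aemeasurable (by fun_prop)]
  refine lintegral_congr fun p => ?_
  rw [← lintegral_mul_const _ (by fun_prop)]
  refine lintegral_congr fun t => ?_
  rw [← ENNReal.ofReal_mul (Real.exp_pos _).le, ← Real.exp_add]
  congr 2
  ring

theorem stmt5 (θ : ℝ) (hθ : 0 < θ) (n : ℕ) (hn : 1 ≤ n) :
    ((gammaM θ).prod ((betaM (θ + (n : ℝ) / 2) (θ + (n : ℝ) / 2)).prod (gammaM ((n : ℝ) / 2)))).map
        (fun p => p.1 * p.2.1 + p.2.2) =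
      ((gammaM (θ + (n : ℝ))).prod (betaM (θ + (n : ℝ) / 2) (θ + (n : ℝ) / 2))).map (fun p => p.1 * p.2) := by
  have hb : (0 : ℝ) < (n : ℝ) / 2 := by positivity
  have hθn : 0 < θ + (n : ℝ) := by positivity
  have ha : 0 < θ + (n : ℝ) / 2 := by positivity
  have := isFiniteMeasure_gammaM hθ
  have := isFiniteMeasure_gammaM hb
  have := isFiniteMeasure_gammaM hθn
  have := isFiniteMeasure_betaM ha ha
  symm
  refine ext_of_lintegral_exp one_pos (fun t ht => ?_) (fun t ht => ?_)
  all_goals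
    have hl : 0 < 1 + -t := by linarith [ht.2]
    have hexp (x : ℝ) : t * x = -(-t * x) := by ring
    simp only [hexp]
    rw [lintegral_exp_map_mul hθn hl]
  · exact lintegral_one_add_mul_rpow_betaM_ne_top ha ha hθn hl
  · rw [lintegral_exp_map_mul_add hθ hb hl, lintegral_one_add_mul_rpow_betaM hl, mul_comm,
      show θ + (n : ℝ) / 2 - (θ + n) = -((n : ℝ) / 2) by ring,
      show 2 * (θ + (n : ℝ) / 2) - (θ + n) = θ by ring]
end

section
/- Let (Y, Σ) be a measurable space, H a probability measure on Y, g : Y → [0, ∞) measurable, z ≥ 0, and θ > 0, and assume ∫ log(1 + z g(y)) H(dy) < ∞. Then θ ∫₀¹ u^{θ−1} exp( −θ ∫ log(1 + u z g(y)) H(dy) ) ( ∫ (1 + u z g(y))^{−1} H(dy) ) du = exp( −θ ∫ log(1 + z g(y)) H(dy) ). -/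
open MeasureTheory Set

/-- The logarithm of `1 + u * h` stays integrable when `h` is scaled down by `u ∈ [0, 1]`. -/
lemma integrable_log_one_add_mul {Y : Type*} [MeasurableSpace Y] {H : Measure Y}
    {h : Y → ℝ} (hm : Measurable h) (h0 : ∀ y, 0 ≤ h y)
    (hint : Integrable (fun y => Real.log (1 + h y)) H) {u : ℝ} (hu : u ∈ Icc (0:ℝ) 1) :
    Integrable (fun y => Real.log (1 + u * h y)) H := by
  refine hint.mono ((hm.const_mul u).const_add 1).log.aestronglyMeasurable
    (Filter.Eventually.of_forall fun y => ?_)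
  have h1 : 0 ≤ u * h y := mul_nonneg hu.1 (h0 y)
  have h2 : u * h y ≤ h y := mul_le_of_le_one_left (h0 y) hu.2
  rw [Real.norm_of_nonneg (Real.log_nonneg (by linarith)),
    Real.norm_of_nonneg (Real.log_nonneg (by linarith))]
  exact Real.log_le_log (by linarith) (by linarith)

lemma continuousOn_integral_log_one_add_mul {Y : Type*} [MeasurableSpace Y] {H : Measure Y}
    {h : Y → ℝ} (hm : Measurable h) (h0 : ∀ y, 0 ≤ h y)
    (hint : Integrable (fun y => Real.log (1 + h y)) H) :
    ContinuousOn (fun u => ∫ y, Real.log (1 + u * h y) ∂H) (Icc (0:ℝ) 1) := by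
  refine continuousOn_of_dominated (bound := fun y => Real.log (1 + h y))
    (fun u _ => ((hm.const_mul u).const_add 1).log.aestronglyMeasurable)
    (fun u hu => Filter.Eventually.of_forall fun y => ?_) hint
    (Filter.Eventually.of_forall fun y => ?_)
  · have h1 : 0 ≤ u * h y := mul_nonneg hu.1 (h0 y)
    have h2 : u * h y ≤ h y := mul_le_of_le_one_left (h0 y) hu.2
    rw [Real.norm_of_nonneg (Real.log_nonneg (by linarith))]
    exact Real.log_le_log (by linarith) (by linarith)
  · refine ContinuousOn.log (by fun_prop) fun u hu => ?_
    have h1 : 0 ≤ u * h y := mul_nonneg hu.1 (h0 y)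
    positivity

lemma hasDerivAt_integral_log_one_add_mul {Y : Type*} [MeasurableSpace Y] {H : Measure Y}
    [IsFiniteMeasure H] {h : Y → ℝ} (hm : Measurable h) (h0 : ∀ y, 0 ≤ h y)
    (hint : Integrable (fun y => Real.log (1 + h y)) H) {u : ℝ} (hu : u ∈ Ioo (0:ℝ) 1) :
    HasDerivAt (fun v => ∫ y, Real.log (1 + v * h y) ∂H) (∫ y, h y / (1 + u * h y) ∂H) u := by
  refine (hasDerivAt_integral_of_dominated_loc_of_deriv_le (s := Ioi (u / 2))
    (F' := fun v y => h y / (1 + v * h y)) (bound := fun _ => 2 / u)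
    (Ioi_mem_nhds (by linarith [hu.1])) (Filter.Eventually.of_forall fun v =>
      ((hm.const_mul v).const_add 1).log.aestronglyMeasurable)
    (integrable_log_one_add_mul hm h0 hint ⟨hu.1.le, hu.2.le⟩)
    (hm.div ((hm.const_mul u).const_add 1)).aestronglyMeasurable
    (Filter.Eventually.of_forall fun y v hv => ?_) (integrable_const _)
    (Filter.Eventually.of_forall fun y v hv => ?_)).2
  · have hu0 := hu.1
    have hv' : u / 2 < v := hv
    have hy := h0 y
    have hv0 : 0 < v := by linarith
    have h1 : 0 ≤ v * h y := by positivity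
    rw [Real.norm_of_nonneg (by positivity), div_le_div_iff₀ (by positivity) hu0]
    nlinarith
  · have hu0 := hu.1
    have hv' : u / 2 < v := hv
    have hy := h0 y
    have hv0 : 0 < v := by linarith
    have h1 : 0 ≤ v * h y := by positivity
    have h2 : HasDerivAt (fun v => 1 + v * h y) (h y) v := by
      simpa using ((hasDerivAt_id v).mul_const (h y)).const_add 1
    exact h2.log (by positivity)

lemma integral_inv_one_add_mul {Y : Type*} [MeasurableSpace Y] {H : Measure Y}
    [IsProbabilityMeasure H] {h : Y → ℝ} (hm : Measurable h) (h0 : ∀ y, 0 ≤ h y)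
    {u : ℝ} (hu : 0 ≤ u) :
    ∫ y, (1 + u * h y)⁻¹ ∂H = 1 - u * ∫ y, h y / (1 + u * h y) ∂H := by
  have h1 : ∀ y, 0 ≤ u * h y := fun y => mul_nonneg hu (h0 y)
  have hi : Integrable (fun y => (1 + u * h y)⁻¹) H := by
    refine Integrable.of_bound (by fun_prop) 1 (Filter.Eventually.of_forall fun y => ?_)
    have := h1 y
    rw [Real.norm_of_nonneg (by positivity)]
    exact inv_le_one_of_one_le₀ (by linarith)
  have he : ∀ y, u * (h y / (1 + u * h y)) = 1 - (1 + u * h y)⁻¹ := fun y => by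
    have := h1 y
    have : 1 + u * h y ≠ 0 := by positivity
    field_simp
    ring
  rw [← integral_const_mul]
  simp_rw [he]
  rw [integral_sub (integrable_const _) hi]
  simp

theorem stmt6 {Y : Type*} [MeasurableSpace Y] (H : Measure Y) [IsProbabilityMeasure H]
    (g : Y → ℝ) (hg : Measurable g) (hg0 : ∀ y, 0 ≤ g y)
    (z θ : ℝ) (hz : 0 ≤ z) (hθ : 0 < θ)
    (hint : Integrable (fun y => Real.log (1 + z * g y)) H) :
    θ * ∫ u in Ioo (0:ℝ) 1,
        u ^ (θ - 1) * Real.exp (-(θ * ∫ y, Real.log (1 + u * z * g y) ∂H)) *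
          ∫ y, (1 + u * z * g y)⁻¹ ∂H =
      Real.exp (-(θ * ∫ y, Real.log (1 + z * g y) ∂H)) := by
  have hm : Measurable fun y => z * g y := hg.const_mul z
  have h0 : ∀ y, 0 ≤ z * g y := fun y => mul_nonneg hz (hg0 y)
  simp_rw [mul_assoc _ z]
  set Φ : ℝ → ℝ := fun u => ∫ y, Real.log (1 + u * (z * g y)) ∂H with hΦ
  set F : ℝ → ℝ := fun u => u ^ θ * Real.exp (-(θ * Φ u)) with hF
  set f : ℝ → ℝ := fun u => θ * (u ^ (θ - 1) * Real.exp (-(θ * Φ u)) *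
    ∫ y, (1 + u * (z * g y))⁻¹ ∂H) with hf
  have hcont : ContinuousOn F (Icc 0 1) :=
    (Real.continuous_rpow_const hθ.le).continuousOn.mul
      (((continuousOn_integral_log_one_add_mul hm h0 hint).const_mul θ).neg.rexp)
  have hderiv : ∀ u ∈ Ioo (0:ℝ) 1, HasDerivAt F (f u) u := fun u hu => by
    have hd := (Real.hasDerivAt_rpow_const (p := θ) (Or.inl hu.1.ne')).mul
      ((hasDerivAt_integral_log_one_add_mul hm h0 hint hu).const_mul θ).neg.exp
    refine hd.congr_deriv ?_
    have hpow : u ^ θ = u ^ (θ - 1) * u := by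
      rw [← Real.rpow_add_one hu.1.ne', sub_add_cancel]
    simp only [hf, integral_inv_one_add_mul hm h0 hu.1.le, hpow, hΦ]
    simp only [Pi.neg_apply]
    ring
  have hnonneg : ∀ u ∈ Ioo (0:ℝ) 1, 0 ≤ f u := fun u hu => by
    have h1 : 0 ≤ ∫ y, (1 + u * (z * g y))⁻¹ ∂H := integral_nonneg fun y =>
      inv_nonneg.2 (add_nonneg zero_le_one (mul_nonneg hu.1.le (h0 y)))
    have := hu.1
    positivity
  have hii : IntervalIntegrable f volume 0 1 :=
    (intervalIntegrable_iff_integrableOn_Ioc_of_le zero_le_one).2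
      (intervalIntegral.integrableOn_deriv_of_nonneg hcont hderiv hnonneg)
  have hftc := intervalIntegral.integral_eq_sub_of_hasDerivAt_of_le zero_le_one hcont hderiv hii
  rw [intervalIntegral.integral_of_le zero_le_one, integral_Ioc_eq_integral_Ioo] at hftc
  rw [← integral_const_mul]
  simpa [hF, hΦ, Real.zero_rpow hθ.ne'] using hftc
end

section
/- Let a, b > 0 and x, y ≥ 0. Then (1/B(a,b)) ∫₀¹ u^{a−1} (1−u)^{b−1} (1 + x u + y (1−u))^{−(a+b)} du = (1+x)^{−a} (1+y)^{−b}. -/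
open MeasureTheory Set

/-- The real Beta integral over the open unit interval. -/
theorem integral_Ioo_rpow_mul_one_sub_rpow {a b : ℝ} (ha : 0 < a) (hb : 0 < b) :
    ∫ u in Ioo (0 : ℝ) 1, u ^ (a - 1) * (1 - u) ^ (b - 1) = ProbabilityTheory.beta a b := by
  rw [ProbabilityTheory.beta_eq_betaIntegralReal a b ha hb, Complex.betaIntegral,
    intervalIntegral.integral_of_le zero_le_one, ← integral_Ioc_eq_integral_Ioo]
  rw [← Complex.ofReal_re (∫ u in Ioc (0 : ℝ) 1, u ^ (a - 1) * (1 - u) ^ (b - 1)),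
    ← integral_complex_ofReal]
  congr 1
  refine setIntegral_congr_fun measurableSet_Ioc fun u hu => ?_
  rw [Complex.ofReal_mul, Complex.ofReal_cpow hu.1.le, Complex.ofReal_cpow (by linarith [hu.2])]
  push_cast
  rfl

theorem mul_add_mul_one_sub_pos {p q u : ℝ} (hp : 0 < p) (hq : 0 < q) (hu : u ∈ Ioo (0 : ℝ) 1) :
    0 < p * u + q * (1 - u) :=
  add_pos (mul_pos hp hu.1) (mul_pos hq (sub_pos.2 hu.2))

/-- The projective transformation `u ↦ p u / (p u + q (1 - u))` of the unit interval. -/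
noncomputable def projUnit (p q u : ℝ) : ℝ := p * u / (p * u + q * (1 - u))

theorem one_sub_projUnit {p q u : ℝ} (h : p * u + q * (1 - u) ≠ 0) :
    1 - projUnit p q u = q * (1 - u) / (p * u + q * (1 - u)) := by
  rw [projUnit, eq_div_iff h, sub_mul, div_mul_cancel₀ _ h]
  ring

theorem projUnit_mem_Ioo {p q u : ℝ} (hp : 0 < p) (hq : 0 < q) (hu : u ∈ Ioo (0 : ℝ) 1) :
    projUnit p q u ∈ Ioo (0 : ℝ) 1 := by
  have hD := mul_add_mul_one_sub_pos hp hq hu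
  refine ⟨div_pos (mul_pos hp hu.1) hD, sub_pos.1 ?_⟩
  rw [one_sub_projUnit hD.ne']
  exact div_pos (mul_pos hq (sub_pos.2 hu.2)) hD

theorem projUnit_projUnit {p q u : ℝ} (hp : 0 < p) (hq : 0 < q) (hu : u ∈ Ioo (0 : ℝ) 1) :
    projUnit q p (projUnit p q u) = u := by
  have hD := mul_add_mul_one_sub_pos hp hq hu
  rw [projUnit, one_sub_projUnit hD.ne', projUnit]
  have h : q * (p * u / (p * u + q * (1 - u))) + p * (q * (1 - u) / (p * u + q * (1 - u))) =
      p * q / (p * u + q * (1 - u)) := by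
    ring
  rw [h]
  field_simp

theorem image_projUnit_Ioo {p q : ℝ} (hp : 0 < p) (hq : 0 < q) :
    projUnit p q '' Ioo (0 : ℝ) 1 = Ioo (0 : ℝ) 1 :=
  Subset.antisymm (image_subset_iff.2 fun _ hu => projUnit_mem_Ioo hp hq hu)
    fun v hv => ⟨projUnit q p v, projUnit_mem_Ioo hq hp hv, projUnit_projUnit hq hp hv⟩

theorem injOn_projUnit {p q : ℝ} (hp : 0 < p) (hq : 0 < q) :
    InjOn (projUnit p q) (Ioo (0 : ℝ) 1) :=
  LeftInvOn.injOn (f₁' := projUnit q p) fun _ hu => projUnit_projUnit hp hq hu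

theorem hasDerivAt_projUnit {p q u : ℝ} (h : p * u + q * (1 - u) ≠ 0) :
    HasDerivAt (projUnit p q) (p * q / (p * u + q * (1 - u)) ^ 2) u := by
  have hn : HasDerivAt (fun u : ℝ => p * u) (p * 1) u := (hasDerivAt_id u).const_mul p
  have hd : HasDerivAt (fun u : ℝ => p * u + q * (1 - u)) (p * 1 + q * (-1)) u :=
    hn.add (((hasDerivAt_id u).const_sub 1).const_mul q)
  refine (hn.div hd h).congr_deriv ?_
  congr 1
  ring

theorem deriv_mul_projUnit_rpow {a b p q u : ℝ} (hp : 0 < p) (hq : 0 < q)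
    (hu : u ∈ Ioo (0 : ℝ) 1) :
    p * q / (p * u + q * (1 - u)) ^ 2 *
        (projUnit p q u ^ (a - 1) * (1 - projUnit p q u) ^ (b - 1)) =
      p ^ a * q ^ b *
        (u ^ (a - 1) * (1 - u) ^ (b - 1) * (p * u + q * (1 - u)) ^ (-(a + b))) := by
  have hD := mul_add_mul_one_sub_pos hp hq hu
  have hu' : 0 < 1 - u := sub_pos.2 hu.2
  rw [one_sub_projUnit hD.ne', projUnit]
  generalize p * u + q * (1 - u) = D at hD
  rw [Real.div_rpow (mul_pos hp hu.1).le hD.le, Real.div_rpow (mul_pos hq hu').le hD.le,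
    Real.mul_rpow hp.le hu.1.le, Real.mul_rpow hq.le hu'.le, Real.rpow_neg hD.le,
    Real.rpow_add hD, Real.rpow_sub_one hp.ne', Real.rpow_sub_one hq.ne',
    Real.rpow_sub_one hD.ne', Real.rpow_sub_one hD.ne']
  have := Real.rpow_pos_of_pos hD a
  have := Real.rpow_pos_of_pos hD b
  field_simp

theorem integral_Ioo_rpow_mul_one_sub_rpow_mul_rpow {a b p q : ℝ} (ha : 0 < a) (hb : 0 < b)
    (hp : 0 < p) (hq : 0 < q) :
    p ^ a * q ^ b * ∫ u in Ioo (0 : ℝ) 1,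
        u ^ (a - 1) * (1 - u) ^ (b - 1) * (p * u + q * (1 - u)) ^ (-(a + b)) =
      ProbabilityTheory.beta a b := by
  rw [← integral_Ioo_rpow_mul_one_sub_rpow ha hb, ← integral_const_mul]
  conv_rhs => rw [← image_projUnit_Ioo hp hq]
  rw [integral_image_eq_integral_abs_deriv_smul measurableSet_Ioo
    (fun u hu => (hasDerivAt_projUnit
      (mul_add_mul_one_sub_pos hp hq hu).ne').hasDerivWithinAt) (injOn_projUnit hp hq)]
  refine setIntegral_congr_fun measurableSet_Ioo fun u hu => ?_
  have hD := mul_add_mul_one_sub_pos hp hq hu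
  simp only [smul_eq_mul]
  rw [abs_of_pos (by positivity), deriv_mul_projUnit_rpow hp hq hu]

theorem stmt11 (a b x y : ℝ) (ha : 0 < a) (hb : 0 < b) (hx : 0 ≤ x) (hy : 0 ≤ y) :
    (1 / (Real.Gamma a * Real.Gamma b / Real.Gamma (a + b))) *
        ∫ u in Ioo (0:ℝ) 1,
          u ^ (a - 1) * (1 - u) ^ (b - 1) * (1 + x * u + y * (1 - u)) ^ (-(a + b)) =
      (1 + x) ^ (-a) * (1 + y) ^ (-b) := by
  have hp : 0 < 1 + x := by positivity
  have hq : 0 < 1 + y := by positivity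
  have key := integral_Ioo_rpow_mul_one_sub_rpow_mul_rpow ha hb hp hq
  have hB := ProbabilityTheory.beta_pos ha hb
  have hD (u : ℝ) : 1 + x * u + y * (1 - u) = (1 + x) * u + (1 + y) * (1 - u) := by ring
  simp only [hD]
  change 1 / ProbabilityTheory.beta a b * _ = _
  have hpa := Real.rpow_pos_of_pos hp a
  have hqb := Real.rpow_pos_of_pos hq b
  rw [Real.rpow_neg hp.le, Real.rpow_neg hq.le, one_div, inv_mul_eq_iff_eq_mul₀ hB.ne', ← key,
    mul_right_comm, mul_mul_mul_comm, mul_inv_cancel₀ hpa.ne', mul_inv_cancel₀ hqb.ne', one_mul,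
    one_mul]
end

section
/- Let a, b > 0 and x, y ≥ 0. Then (1/B(a,b)) ∫₀¹ u^{a−1} (1−u)^{b−1} (1 + x u + y (1−u))^{−1} du = ∫₀¹ (1 + v x)^{−a} (1 + v y)^{−b} ( a/(1+vx) + b/(1+vy) ) (1−v)^{a+b−1} dv. -/
open MeasureTheory Set

theorem setIntegral_rpow_mul_one_sub_rpow {a b : ℝ} (ha : 0 < a) (hb : 0 < b) :
    ∫ u in Ioo (0:ℝ) 1, u ^ (a - 1) * (1 - u) ^ (b - 1) =
      Real.Gamma a * Real.Gamma b / Real.Gamma (a + b) := by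
  have h := Complex.betaIntegral_eq_Gamma_mul_div a b (by simpa) (by simpa)
  rw [Complex.betaIntegral, intervalIntegral.integral_of_le zero_le_one,
    integral_Ioc_eq_integral_Ioo] at h
  have h' : ∫ u in Ioo (0:ℝ) 1, (u : ℂ) ^ ((a : ℂ) - 1) * (1 - (u : ℂ)) ^ ((b : ℂ) - 1) =
      ∫ u in Ioo (0:ℝ) 1, ((u ^ (a - 1) * (1 - u) ^ (b - 1) : ℝ) : ℂ) := by
    refine setIntegral_congr_fun measurableSet_Ioo fun u hu ↦ ?_
    push_cast
    rw [Complex.ofReal_cpow hu.1.le, Complex.ofReal_cpow (sub_nonneg.2 hu.2.le)]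
    push_cast
    rfl
  rw [h', integral_complex_ofReal, ← Complex.ofReal_add, Complex.Gamma_ofReal,
    Complex.Gamma_ofReal, Complex.Gamma_ofReal] at h
  exact_mod_cast h

theorem Gamma_mul_Gamma_div_Gamma_pos {a b : ℝ} (ha : 0 < a) (hb : 0 < b) :
    0 < Real.Gamma a * Real.Gamma b / Real.Gamma (a + b) :=
  ProbabilityTheory.beta_pos ha hb

theorem integrableOn_rpow_mul_one_sub_rpow {a b : ℝ} (ha : 0 < a) (hb : 0 < b) :
    IntegrableOn (fun u : ℝ ↦ u ^ (a - 1) * (1 - u) ^ (b - 1)) (Ioo 0 1) :=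
  Integrable.of_integral_ne_zero <| by
    rw [setIntegral_rpow_mul_one_sub_rpow ha hb]
    exact (Gamma_mul_Gamma_div_Gamma_pos ha hb).ne'

theorem convexComb_pos {p q u : ℝ} (hp : 0 < p) (hq : 0 < q) (hu : u ∈ Ioo (0:ℝ) 1) :
    0 < p * u + q * (1 - u) :=
  add_pos (mul_pos hp hu.1) (mul_pos hq (sub_pos.2 hu.2))

theorem image_projective_Ioo {p q : ℝ} (hp : 0 < p) (hq : 0 < q) :
    (fun u : ℝ ↦ p * u / (p * u + q * (1 - u))) '' Ioo 0 1 = Ioo 0 1 := by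
  ext s
  constructor
  · rintro ⟨u, hu, rfl⟩
    have hD := convexComb_pos hp hq hu
    refine ⟨div_pos (mul_pos hp hu.1) hD, (div_lt_one hD).2 ?_⟩
    linarith [mul_pos hq (sub_pos.2 hu.2)]
  · intro hs
    have hE := convexComb_pos hq hp hs
    refine ⟨q * s / (q * s + p * (1 - s)), ⟨div_pos (mul_pos hq hs.1) hE, (div_lt_one hE).2 ?_⟩, ?_⟩
    · linarith [mul_pos hp (sub_pos.2 hs.2)]
    · have h1 : p * (q * s / (q * s + p * (1 - s))) +
          q * (1 - q * s / (q * s + p * (1 - s))) = p * q / (q * s + p * (1 - s)) := by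
        field_simp
        ring
      simp only [h1]
      field_simp

/-- The Markov–Krein identity for the Beta distribution. -/
theorem setIntegral_beta_mul_convexComb_rpow {a b p q : ℝ} (ha : 0 < a) (hb : 0 < b)
    (hp : 0 < p) (hq : 0 < q) :
    ∫ u in Ioo (0:ℝ) 1, u ^ (a - 1) * (1 - u) ^ (b - 1) * (p * u + q * (1 - u)) ^ (-(a + b)) =
      p ^ (-a) * q ^ (-b) * (Real.Gamma a * Real.Gamma b / Real.Gamma (a + b)) := by
  have hderiv : ∀ u ∈ Ioo (0:ℝ) 1, HasDerivWithinAt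
      (fun u : ℝ ↦ p * u / (p * u + q * (1 - u))) (p * q / (p * u + q * (1 - u)) ^ 2)
      (Ioo 0 1) u := by
    intro u hu
    have hD := convexComb_pos hp hq hu
    have h1 : HasDerivAt (fun u : ℝ ↦ p * u) p u := by
      simpa using (hasDerivAt_id u).const_mul p
    have h2 : HasDerivAt (fun u : ℝ ↦ p * u + q * (1 - u)) (p + q * (-1)) u :=
      h1.add (((hasDerivAt_id u).const_sub 1).const_mul q)
    refine ((h1.div h2 hD.ne').congr_deriv ?_).hasDerivWithinAt
    congr 1
    ring
  have hinj : InjOn (fun u : ℝ ↦ p * u / (p * u + q * (1 - u))) (Ioo 0 1) := by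
    intro u hu v hv h
    have hD := convexComb_pos hp hq hu
    have hE := convexComb_pos hp hq hv
    simp only [div_eq_div_iff hD.ne' hE.ne'] at h
    have : p * q * (u - v) = 0 := by linear_combination h
    have hpq := (mul_pos hp hq).ne'
    exact sub_eq_zero.1 ((mul_eq_zero.1 this).resolve_left hpq)
  have key := integral_image_eq_integral_abs_deriv_smul measurableSet_Ioo hderiv hinj
    (fun s ↦ s ^ (a - 1) * (1 - s) ^ (b - 1))
  rw [image_projective_Ioo hp hq, setIntegral_rpow_mul_one_sub_rpow ha hb] at key
  rw [key, ← integral_const_mul]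
  refine setIntegral_congr_fun measurableSet_Ioo fun u hu ↦ ?_
  have hD := convexComb_pos hp hq hu
  have hu' : 0 < 1 - u := sub_pos.2 hu.2
  have h1 : 1 - p * u / (p * u + q * (1 - u)) = q * (1 - u) / (p * u + q * (1 - u)) := by
    field_simp
    ring
  simp only [h1, smul_eq_mul]
  generalize p * u + q * (1 - u) = D at hD
  rw [abs_of_pos (by positivity), Real.div_rpow (mul_pos hp hu.1).le hD.le,
    Real.div_rpow (mul_pos hq hu').le hD.le, Real.mul_rpow hp.le hu.1.le,
    Real.mul_rpow hq.le hu'.le, Real.rpow_neg hD.le, Real.rpow_neg hp.le, Real.rpow_neg hq.le,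
    Real.rpow_add hD, Real.rpow_sub_one hp.ne', Real.rpow_sub_one hq.ne',
    Real.rpow_sub_one hD.ne', Real.rpow_sub_one hD.ne']
  have := Real.rpow_pos_of_pos hp a
  have := Real.rpow_pos_of_pos hq b
  have := Real.rpow_pos_of_pos hD a
  have := Real.rpow_pos_of_pos hD b
  field_simp

theorem integrableOn_beta_mul_convexComb_rpow {a b p q : ℝ} (ha : 0 < a) (hb : 0 < b)
    (hp : 0 < p) (hq : 0 < q) :
    IntegrableOn (fun u : ℝ ↦
      u ^ (a - 1) * (1 - u) ^ (b - 1) * (p * u + q * (1 - u)) ^ (-(a + b))) (Ioo 0 1) :=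
  Integrable.of_integral_ne_zero <| by
    rw [setIntegral_beta_mul_convexComb_rpow ha hb hp hq]
    have := Gamma_mul_Gamma_div_Gamma_pos ha hb
    positivity

theorem setIntegral_beta_mul_convexComb_rpow_add_one {a b p q : ℝ} (ha : 0 < a) (hb : 0 < b)
    (hp : 0 < p) (hq : 0 < q) :
    ∫ u in Ioo (0:ℝ) 1, u ^ (a - 1) * (1 - u) ^ (b - 1) *
        ((a + b) * (p * u + q * (1 - u)) ^ (-(a + b + 1))) =
      Real.Gamma a * Real.Gamma b / Real.Gamma (a + b) *
        (p ^ (-a) * q ^ (-b) * (a / p + b / q)) := by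
  have ha1 : 0 < a + 1 := by linarith
  have hb1 : 0 < b + 1 := by linarith
  have hsplit : ∀ u ∈ Ioo (0:ℝ) 1, u ^ (a - 1) * (1 - u) ^ (b - 1) *
        ((a + b) * (p * u + q * (1 - u)) ^ (-(a + b + 1))) =
      (a + b) * (u ^ (a + 1 - 1) * (1 - u) ^ (b - 1) *
          (p * u + q * (1 - u)) ^ (-(a + 1 + b)) +
        u ^ (a - 1) * (1 - u) ^ (b + 1 - 1) *
          (p * u + q * (1 - u)) ^ (-(a + (b + 1)))) := by
    intro u hu
    have hu0 : u ≠ 0 := hu.1.ne'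
    have hu1 : 1 - u ≠ 0 := (sub_pos.2 hu.2).ne'
    rw [show a + 1 - 1 = a - 1 + 1 by ring, show b + 1 - 1 = b - 1 + 1 by ring,
      Real.rpow_add_one hu0, Real.rpow_add_one hu1, show a + 1 + b = a + b + 1 by ring,
      show a + (b + 1) = a + b + 1 by ring]
    ring
  rw [setIntegral_congr_fun measurableSet_Ioo hsplit, integral_const_mul,
    integral_add (integrableOn_beta_mul_convexComb_rpow ha1 hb hp hq)
      (integrableOn_beta_mul_convexComb_rpow ha hb1 hp hq),
    setIntegral_beta_mul_convexComb_rpow ha1 hb hp hq,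
    setIntegral_beta_mul_convexComb_rpow ha hb1 hp hq, show a + 1 + b = a + b + 1 by ring,
    show a + (b + 1) = a + b + 1 by ring, Real.Gamma_add_one ha.ne', Real.Gamma_add_one hb.ne',
    Real.Gamma_add_one (add_pos ha hb).ne', neg_add', neg_add', Real.rpow_sub_one hp.ne',
    Real.rpow_sub_one hq.ne']
  have := Real.Gamma_pos_of_pos (add_pos ha hb)
  have := add_pos ha hb
  field_simp

theorem setIntegral_one_sub_rpow_mul_rpow {t P : ℝ} (ht : 0 < t) (hP : 0 ≤ P) :
    ∫ v in Ioo (0:ℝ) 1, (1 - v) ^ (t - 1) * (t * (1 + v * P) ^ (-(t + 1))) = (1 + P)⁻¹ := by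
  have hpos : ∀ v : ℝ, 0 ≤ v → 0 < 1 + v * P := fun v hv ↦ by positivity
  have hcont : ContinuousOn (fun v : ℝ ↦ -(((1 - v) / (1 + v * P)) ^ t / (1 + P))) (Icc 0 1) := by
    refine ((ContinuousOn.rpow_const (ContinuousOn.div (by fun_prop) (by fun_prop)
      fun v hv ↦ (hpos v hv.1).ne') fun _ _ ↦ Or.inr ht.le).div_const _).neg
  have hderiv : ∀ v ∈ Ioo (0:ℝ) 1,
      HasDerivAt (fun v : ℝ ↦ -(((1 - v) / (1 + v * P)) ^ t / (1 + P)))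
        ((1 - v) ^ (t - 1) * (t * (1 + v * P) ^ (-(t + 1)))) v := by
    intro v hv
    have hD := hpos v hv.1.le
    have hv' : 0 < 1 - v := sub_pos.2 hv.2
    have h1 : HasDerivAt (fun v : ℝ ↦ 1 - v) (-1) v := (hasDerivAt_id v).const_sub 1
    have h2 : HasDerivAt (fun v : ℝ ↦ 1 + v * P) (1 * P) v :=
      ((hasDerivAt_id v).mul_const P).const_add 1
    have h3 := (((h1.div h2 hD.ne').rpow_const (p := t)
      (Or.inl (div_pos hv' hD).ne')).div_const (1 + P)).neg
    refine h3.congr_deriv ?_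
    have hP1 : 0 < 1 + P := by linarith
    simp only [Pi.div_apply]
    rw [Real.div_rpow hv'.le hD.le, neg_add', Real.rpow_sub_one hD.ne', Real.rpow_sub_one hD.ne',
      Real.rpow_neg hD.le]
    have := Real.rpow_pos_of_pos hD t
    field_simp
    ring
  have hint := intervalIntegral.integrableOn_deriv_of_nonneg hcont hderiv fun v hv ↦ by
    have := hpos v hv.1.le
    have := sub_pos.2 hv.2
    positivity
  rw [← integral_Ioc_eq_integral_Ioo, ← intervalIntegral.integral_of_le zero_le_one,
    intervalIntegral.integral_eq_sub_of_hasDerivAt_of_le zero_le_one hcont hderiv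
      ((intervalIntegrable_iff_integrableOn_Ioc_of_le zero_le_one).2 hint)]
  simp [Real.zero_rpow ht.ne']

theorem integrable_beta_mul_rpow_prod {a b x y : ℝ} (ha : 0 < a) (hb : 0 < b) (hx : 0 ≤ x)
    (hy : 0 ≤ y) :
    Integrable (Function.uncurry fun u v : ℝ ↦ u ^ (a - 1) * (1 - u) ^ (b - 1) *
        ((1 - v) ^ (a + b - 1) *
          ((a + b) * (1 + v * (x * u + y * (1 - u))) ^ (-(a + b + 1)))))
      ((volume.restrict (Ioo (0:ℝ) 1)).prod (volume.restrict (Ioo (0:ℝ) 1))) := by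
  have hv : IntegrableOn (fun v : ℝ ↦ (1 - v) ^ (a + b - 1)) (Ioo 0 1) := by
    simpa using integrableOn_rpow_mul_one_sub_rpow one_pos (add_pos ha hb)
  refine (((integrableOn_rpow_mul_one_sub_rpow ha hb).mul_prod hv).mul_const (a + b)).mono'
    (Measurable.aestronglyMeasurable (by unfold Function.uncurry; fun_prop)) ?_
  rw [Measure.prod_restrict]
  refine ae_restrict_of_forall_mem (measurableSet_Ioo.prod measurableSet_Ioo) ?_
  rintro ⟨u, v⟩ ⟨⟨hu0, hu1⟩, ⟨hv0, hv1⟩⟩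
  simp only [Function.uncurry] at *
  have hu' : 0 < 1 - u := sub_pos.2 hu1
  have hv' : 0 < 1 - v := sub_pos.2 hv1
  have hP : 0 ≤ v * (x * u + y * (1 - u)) := by positivity
  have hle : (1 + v * (x * u + y * (1 - u))) ^ (-(a + b + 1)) ≤ 1 :=
    Real.rpow_le_one_of_one_le_of_nonpos (by linarith) (by linarith)
  rw [Real.norm_of_nonneg (by positivity), mul_assoc (u ^ (a - 1) * (1 - u) ^ (b - 1))]
  gcongr
  exact mul_le_of_le_one_right (by positivity) hle

theorem stmt13 (a b x y : ℝ) (ha : 0 < a) (hb : 0 < b) (hx : 0 ≤ x) (hy : 0 ≤ y) :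
    (1 / (Real.Gamma a * Real.Gamma b / Real.Gamma (a + b))) *
        ∫ u in Ioo (0:ℝ) 1,
          u ^ (a - 1) * (1 - u) ^ (b - 1) * (1 + x * u + y * (1 - u))⁻¹ =
      ∫ v in Ioo (0:ℝ) 1,
        (1 + v * x) ^ (-a) * (1 + v * y) ^ (-b) *
          (a / (1 + v * x) + b / (1 + v * y)) * (1 - v) ^ (a + b - 1) := by
  have hswap := integral_integral_swap (integrable_beta_mul_rpow_prod ha hb hx hy)
  have hleft : ∫ u in Ioo (0:ℝ) 1, ∫ v in Ioo (0:ℝ) 1, u ^ (a - 1) * (1 - u) ^ (b - 1) *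
        ((1 - v) ^ (a + b - 1) *
          ((a + b) * (1 + v * (x * u + y * (1 - u))) ^ (-(a + b + 1)))) =
      ∫ u in Ioo (0:ℝ) 1, u ^ (a - 1) * (1 - u) ^ (b - 1) * (1 + x * u + y * (1 - u))⁻¹ := by
    refine setIntegral_congr_fun measurableSet_Ioo fun u hu ↦ ?_
    have := hu.1
    have := sub_pos.2 hu.2
    rw [integral_const_mul, setIntegral_one_sub_rpow_mul_rpow (add_pos ha hb) (by positivity),
      add_assoc 1]
  have hright : ∫ v in Ioo (0:ℝ) 1, ∫ u in Ioo (0:ℝ) 1, u ^ (a - 1) * (1 - u) ^ (b - 1) *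
        ((1 - v) ^ (a + b - 1) *
          ((a + b) * (1 + v * (x * u + y * (1 - u))) ^ (-(a + b + 1)))) =
      Real.Gamma a * Real.Gamma b / Real.Gamma (a + b) * ∫ v in Ioo (0:ℝ) 1,
        (1 + v * x) ^ (-a) * (1 + v * y) ^ (-b) *
          (a / (1 + v * x) + b / (1 + v * y)) * (1 - v) ^ (a + b - 1) := by
    rw [← integral_const_mul]
    refine setIntegral_congr_fun measurableSet_Ioo fun v hv ↦ ?_
    have := hv.1
    rw [← mul_assoc, ← setIntegral_beta_mul_convexComb_rpow_add_one ha hb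
      (by positivity : 0 < 1 + v * x) (by positivity : 0 < 1 + v * y), ← integral_mul_const]
    congr with u
    rw [show (1 + v * x) * u + (1 + v * y) * (1 - u) = 1 + v * (x * u + y * (1 - u)) by ring]
    ring
  rw [← hleft, hswap, hright, one_div, inv_mul_cancel_left₀]
  exact (Gamma_mul_Gamma_div_Gamma_pos ha hb).ne'
end
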